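/- Let E be a non-trivial equational theory, Γ an E-unification problem, and S a set of E-unifiers of Γ such that VRan(σ) ∪ Dom(σ) ⊆ Var(Γ) holds for all σ ∈ S, and such that S is complete w.r.t. the restricted instantiation preorder ≤_E^{Var(Γ)} or w.r.t. the unrestricted instantiation preorder ≤_E^V. Then the restricted and the unrestricted E-unification types of Γ coincide. -/

import Mathlib

namespace UnifFW

/-- First-order terms over a signature `F` (an arity-indexed family of function
symbols), with variables from the countably infinite set `V = ℕ`. -/
inductive Term (F : ℕ → Type) : Type
  | var : ℕ → Term F
  | app : (n : ℕ) → F n → (Fin n → Term F) → Term F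

variable {F : ℕ → Type}

/-- The set of variables occurring in a term. -/
def Term.vars : Term F → Set ℕ
  | .var x => {x}
  | .app _ _ ts => ⋃ i, (ts i).vars

/-- Homomorphic extension of a map `V → T(Σ,V)` to terms. -/
def Term.subst (σ : ℕ → Term F) : Term F → Term F
  | .var x => σ x
  | .app n f ts => .app n f (fun i => (ts i).subst σ)

/-- The congruence `≈_E` induced by a set `E` of identities: the smallest
equivalence relation containing all substitution instances of identities of `E`
and compatible with the term constructors. -/
inductive EqE (E : Set (Term F × Term F)) : Term F → Term F → Prop
  | ax {s t : Term F} (σ : ℕ → Term F) : (s, t) ∈ E → EqE E (s.subst σ) (t.subst σ)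
  | refl (t : Term F) : EqE E t t
  | symm {s t : Term F} : EqE E s t → EqE E t s
  | trans {s t u : Term F} : EqE E s t → EqE E t u → EqE E s u
  | congr {n : ℕ} (f : F n) {ts us : Fin n → Term F} :
      (∀ i, EqE E (ts i) (us i)) → EqE E (.app n f ts) (.app n f us)

/-- A theory is non-trivial if distinct variables are not equated. -/
def NonTrivial (E : Set (Term F × Term F)) : Prop :=
  ∀ x y : ℕ, x ≠ y → ¬ EqE E (.var x) (.var y)

/-- A theory is regular if both sides of each identity have the same variables. -/
def Regular (E : Set (Term F × Term F)) : Prop :=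
  ∀ p ∈ E, (Prod.fst p).vars = (Prod.snd p).vars

/-- A substitution: a map `V → T(Σ,V)` with finite domain. -/
structure Subst (F : ℕ → Type) where
  toFun : ℕ → Term F
  finite_dom : {x : ℕ | toFun x ≠ Term.var x}.Finite

/-- The domain of a substitution. -/
def Subst.Dom (σ : Subst F) : Set ℕ := {x : ℕ | σ.toFun x ≠ Term.var x}

/-- The variable range of a substitution: all variables occurring in the images
of domain variables. -/
def Subst.VRan (σ : Subst F) : Set ℕ := ⋃ x ∈ σ.Dom, (σ.toFun x).vars

/-- The instantiation preorder `σ ≤_E^X θ`: some substitution `λ` satisfies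
`λ(σ(x)) ≈_E θ(x)` for all `x ∈ X`. -/
def InstLE (E : Set (Term F × Term F)) (X : Set ℕ) (σ θ : Subst F) : Prop :=
  ∃ lam : Subst F, ∀ x ∈ X, EqE E ((σ.toFun x).subst lam.toFun) (θ.toFun x)

/-- The equivalence `σ ∼_E^X θ` induced by the instantiation preorder. -/
def InstEquiv (E : Set (Term F × Term F)) (X : Set ℕ) (σ θ : Subst F) : Prop :=
  InstLE E X σ θ ∧ InstLE E X θ σ

/-- The strict instantiation order `σ <_E^X θ`. -/
def InstLT (E : Set (Term F × Term F)) (X : Set ℕ) (σ θ : Subst F) : Prop :=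
  InstLE E X σ θ ∧ ¬ InstLE E X θ σ

/-- The set of variables occurring in a unification problem. -/
def VarsP (Γ : Set (Term F × Term F)) : Set ℕ :=
  ⋃ p ∈ Γ, (Prod.fst p).vars ∪ (Prod.snd p).vars

/-- `σ` is an `E`-unifier of the unification problem `Γ`. -/
def Unifier (E Γ : Set (Term F × Term F)) (σ : Subst F) : Prop :=
  ∀ p ∈ Γ, EqE E ((Prod.fst p).subst σ.toFun) ((Prod.snd p).subst σ.toFun)

/-- A unification problem is solvable if it has a unifier. -/
def Solvable (E Γ : Set (Term F × Term F)) : Prop := ∃ σ : Subst F, Unifier E Γ σ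

/-- `S` is a complete set of `E`-unifiers of `Γ` w.r.t. `≤_E^X`. -/
def CompleteSet (E Γ : Set (Term F × Term F)) (X : Set ℕ) (S : Set (Subst F)) : Prop :=
  (∀ σ ∈ S, Unifier E Γ σ) ∧ ∀ θ : Subst F, Unifier E Γ θ → ∃ σ ∈ S, InstLE E X σ θ

/-- `S` is a minimal complete set of `E`-unifiers of `Γ` w.r.t. `≤_E^X`:
complete, and no two distinct elements are comparable. -/
def MinimalComplete (E Γ : Set (Term F × Term F)) (X : Set ℕ) (S : Set (Subst F)) : Prop :=
  CompleteSet E Γ X S ∧ ∀ σ ∈ S, ∀ θ ∈ S, σ ≠ θ → ¬ InstLE E X σ θ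

/-- `Γ` has unification type unitary w.r.t. `≤_E^X`. -/
def TypeUnitary (E Γ : Set (Term F × Term F)) (X : Set ℕ) : Prop :=
  ∃ σ : Subst F, MinimalComplete E Γ X {σ}

/-- `Γ` has unification type finitary w.r.t. `≤_E^X`. -/
def TypeFinitary (E Γ : Set (Term F × Term F)) (X : Set ℕ) : Prop :=
  ∃ S : Set (Subst F), MinimalComplete E Γ X S ∧ S.Finite ∧ 1 < S.ncard

/-- `Γ` has unification type infinitary w.r.t. `≤_E^X`. -/
def TypeInfinitary (E Γ : Set (Term F × Term F)) (X : Set ℕ) : Prop :=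
  ∃ S : Set (Subst F), MinimalComplete E Γ X S ∧ S.Infinite

/-- `Γ` has unification type zero w.r.t. `≤_E^X`. -/
def TypeZero (E Γ : Set (Term F × Term F)) (X : Set ℕ) : Prop :=
  ¬ ∃ S : Set (Subst F), MinimalComplete E Γ X S

/-- `σ` is a `≤_E^X`-minimal `E`-unifier of `Γ`. -/
def MinUnifier (E Γ : Set (Term F × Term F)) (X : Set ℕ) (σ : Subst F) : Prop :=
  Unifier E Γ σ ∧ ∀ θ : Subst F, Unifier E Γ θ → InstLE E X θ σ → InstLE E X σ θ

/-- The set `C_E(Γ)` of unifiers all of whose range variables occur in the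
images of at least two distinct variables. -/
def CSet (E Γ : Set (Term F × Term F)) : Set (Subst F) :=
  {σ : Subst F | Unifier E Γ σ ∧
    ∀ y ∈ σ.VRan, ∃ x x' : ℕ, x ≠ x' ∧ y ∈ (σ.toFun x).vars ∩ (σ.toFun x').vars}

/-- `E` is Noetherian w.r.t. the unrestricted instantiation preorder: there is
no infinite strictly descending chain `σ₁ >_E^V σ₂ >_E^V ⋯`. -/
def Noetherian (E : Set (Term F × Term F)) : Prop :=
  ¬ ∃ f : ℕ → Subst F, ∀ n : ℕ, InstLT E Set.univ (f (n + 1)) (f n)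


theorem Term.subst_subst (σ τ : ℕ → Term F) (t : Term F) :
    (t.subst σ).subst τ = t.subst fun x => (σ x).subst τ := by
  induction t with
  | var x => rfl
  | app n f ts ih => simp only [Term.subst, ih]

theorem Term.subst_congr {σ τ : ℕ → Term F} {t : Term F} (h : ∀ x ∈ t.vars, σ x = τ x) :
    t.subst σ = t.subst τ := by
  induction t with
  | var x => exact h x rfl
  | app n f ts ih =>
    simp only [Term.subst, Term.app.injEq, heq_eq_eq, true_and]
    exact funext fun i => ih i fun x hx => h x (Set.mem_iUnion.2 ⟨i, hx⟩)

theorem EqE.subst {E : Set (Term F × Term F)} {s t : Term F} (h : EqE E s t) (τ : ℕ → Term F) :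
    EqE E (s.subst τ) (t.subst τ) := by
  induction h with
  | ax σ h =>
    rw [Term.subst_subst, Term.subst_subst]
    exact .ax _ h
  | refl t => exact .refl _
  | symm _ ih => exact ih.symm
  | trans _ _ ih₁ ih₂ => exact ih₁.trans ih₂
  | congr f _ ih => exact .congr f ih

/-- The substitution applying first `σ` and then `τ`. -/
def Subst.comp (σ τ : Subst F) : Subst F where
  toFun x := (σ.toFun x).subst τ.toFun
  finite_dom := (σ.finite_dom.union τ.finite_dom).subset fun x hx => by
    by_contra h
    simp only [Set.mem_union, Set.mem_ofPred_eq, not_or, not_not] at h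
    exact hx (by rw [h.1, Term.subst, h.2])

open Classical in
/-- The substitution that agrees with `σ` on `X` and with `τ` outside `X`. -/
noncomputable def Subst.piecewise (X : Set ℕ) (σ τ : Subst F) : Subst F where
  toFun := X.piecewise σ.toFun τ.toFun
  finite_dom := (σ.finite_dom.union τ.finite_dom).subset fun x hx => by
    by_cases h : x ∈ X
    · exact .inl (by simpa [h] using hx)
    · exact .inr (by simpa [h] using hx)

theorem InstLE.trans {E : Set (Term F × Term F)} {X : Set ℕ} {σ θ ρ : Subst F}
    (h₁ : InstLE E X σ θ) (h₂ : InstLE E X θ ρ) : InstLE E X σ ρ := by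
  obtain ⟨l, hl⟩ := h₁
  obtain ⟨m, hm⟩ := h₂
  refine ⟨l.comp m, fun x hx => ?_⟩
  have h := (hl x hx).subst m.toFun
  rw [Term.subst_subst] at h
  exact h.trans (hm x hx)

open Classical in
/-- A substitution that lives on `X` is as general w.r.t. `X` as w.r.t. all variables. -/
theorem instLE_iff_univ {E : Set (Term F × Term F)} {X : Set ℕ} {σ : Subst F}
    (hσ : σ.VRan ∪ σ.Dom ⊆ X) (θ : Subst F) : InstLE E X σ θ ↔ InstLE E Set.univ σ θ := by
  refine ⟨fun ⟨l, hl⟩ => ⟨l.piecewise X θ, fun x _ => ?_⟩,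
    fun ⟨l, hl⟩ => ⟨l, fun x _ => hl x trivial⟩⟩
  by_cases hx : x ∈ X
  · have hv : (σ.toFun x).vars ⊆ X := by
      by_cases hd : x ∈ σ.Dom
      · exact (Set.subset_biUnion_of_mem (u := fun x => (σ.toFun x).vars) hd).trans
          (Set.subset_union_left.trans hσ)
      · rw [show σ.toFun x = .var x from not_not.1 hd]
        exact Set.singleton_subset_iff.2 hx
    rw [Term.subst_congr (τ := l.toFun) fun y hy => Set.piecewise_eq_of_mem X _ _ (hv hy)]
    exact hl x hx
  · rw [show σ.toFun x = .var x from not_not.1 fun hd => hx (hσ (.inr hd)), Term.subst,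
      show (l.piecewise X θ).toFun x = θ.toFun x from Set.piecewise_eq_of_notMem X _ _ hx]
    exact .refl _

theorem completeSet_congr {E Γ : Set (Term F × Term F)} {X Y : Set ℕ} {S : Set (Subst F)}
    (h : ∀ σ ∈ S, ∀ θ, InstLE E X σ θ ↔ InstLE E Y σ θ) :
    CompleteSet E Γ X S ↔ CompleteSet E Γ Y S :=
  and_congr_right fun _ => forall₂_congr fun θ _ =>
    exists_congr fun σ => and_congr_right fun hσ => h σ hσ θ

/-- A minimal complete set can be replaced, element by element, by one inside a given complete
set. -/
theorem MinimalComplete.exists_image_subset {E Γ : Set (Term F × Term F)} {X : Set ℕ}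
    {S M : Set (Subst F)} (hM : MinimalComplete E Γ X M) (hS : CompleteSet E Γ X S) :
    ∃ f : Subst F → Subst F, Set.InjOn f M ∧ f '' M ⊆ S ∧ MinimalComplete E Γ X (f '' M) := by
  obtain ⟨⟨hMu, hMc⟩, hMm⟩ := hM
  have key : ∀ m, ∃ s, m ∈ M → s ∈ S ∧ InstLE E X s m ∧ InstLE E X m s := by
    intro m
    by_cases hm : m ∈ M
    · obtain ⟨s, hs, hsm⟩ := hS.2 m (hMu m hm)
      obtain ⟨m', hm', hms⟩ := hMc s (hS.1 s hs)
      obtain rfl : m' = m := by_contra fun hne => hMm m' hm' m hm hne (hms.trans hsm)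
      exact ⟨s, fun _ => ⟨hs, hsm, hms⟩⟩
    · exact ⟨m, fun h => absurd h hm⟩
  choose f hf using key
  have hle : ∀ m ∈ M, ∀ m' ∈ M, InstLE E X (f m) (f m') → m = m' := fun m hm m' hm' h =>
    by_contra fun hne => hMm m hm m' hm' hne (((hf m hm).2.2.trans h).trans (hf m' hm').2.1)
  have hsub : f '' M ⊆ S := Set.image_subset_iff.2 fun m hm => (hf m hm).1
  refine ⟨f, fun m hm m' hm' h => ?_, hsub,
    ⟨fun σ hσ => hS.1 σ (hsub hσ), fun θ hθ => ?_⟩, ?_⟩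
  · exact by_contra fun hne => hMm m hm m' hm' hne
      ((hf m hm).2.2.trans (h ▸ (hf m' hm').2.1))
  · obtain ⟨m, hm, hmθ⟩ := hMc θ hθ
    exact ⟨f m, ⟨m, hm, rfl⟩, (hf m hm).2.1.trans hmθ⟩
  · rintro _ ⟨m, hm, rfl⟩ _ ⟨m', hm', rfl⟩ hne h
    exact hne (congrArg f (hle m hm m' hm' h))

/-- If `≤_E^X` and `≤_E^Y` agree above the elements of a complete set, then minimal complete sets
w.r.t. `≤_E^X` yield equipotent ones w.r.t. `≤_E^Y`. -/
theorem MinimalComplete.exists_image {E Γ : Set (Term F × Term F)} {X Y : Set ℕ}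
    {S M : Set (Subst F)} (hM : MinimalComplete E Γ X M) (hS : CompleteSet E Γ X S)
    (h : ∀ σ ∈ S, ∀ θ, InstLE E X σ θ ↔ InstLE E Y σ θ) :
    ∃ f : Subst F → Subst F, Set.InjOn f M ∧ MinimalComplete E Γ Y (f '' M) := by
  obtain ⟨f, hinj, hsub, hc, hm⟩ := hM.exists_image_subset hS
  exact ⟨f, hinj, (completeSet_congr fun σ hσ => h σ (hsub hσ)).1 hc,
    fun σ hσ θ hθ hne hle => hm σ hσ θ hθ hne ((h σ (hsub hσ) θ).2 hle)⟩

theorem types_imp_of_instLE_iff {E Γ : Set (Term F × Term F)} {X Y : Set ℕ} {S : Set (Subst F)}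
    (hS : CompleteSet E Γ X S) (h : ∀ σ ∈ S, ∀ θ, InstLE E X σ θ ↔ InstLE E Y σ θ) :
    (TypeUnitary E Γ X → TypeUnitary E Γ Y) ∧ (TypeFinitary E Γ X → TypeFinitary E Γ Y) ∧
    (TypeInfinitary E Γ X → TypeInfinitary E Γ Y) ∧ (TypeZero E Γ Y → TypeZero E Γ X) := by
  refine ⟨?_, ?_, ?_, ?_⟩
  · rintro ⟨σ, hσ⟩
    obtain ⟨f, -, hf⟩ := hσ.exists_image hS h
    exact ⟨f σ, by rwa [Set.image_singleton] at hf⟩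
  · rintro ⟨M, hM, hfin, hcard⟩
    obtain ⟨f, hinj, hf⟩ := hM.exists_image hS h
    exact ⟨_, hf, hfin.image f, by rwa [hinj.ncard_image]⟩
  · rintro ⟨M, hM, hinf⟩
    obtain ⟨f, hinj, hf⟩ := hM.exists_image hS h
    exact ⟨_, hf, hinf.image hinj⟩
  · rintro hY ⟨M, hM⟩
    obtain ⟨f, -, hf⟩ := hM.exists_image hS h
    exact hY ⟨_, hf⟩

/-- Theorem `stays:same:thm`: if `S` is a set of `E`-unifiers
of `Γ` with `VRan(σ) ∪ Dom(σ) ⊆ Var(Γ)` for all `σ ∈ S` that is complete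
w.r.t. the restricted or the unrestricted instantiation preorder, then the
restricted and the unrestricted `E`-unification types of `Γ` coincide. -/
theorem stmt3 {F : ℕ → Type} (E : Set (Term F × Term F)) (hE : NonTrivial E)
    (Γ : Set (Term F × Term F)) (hΓ : Γ.Finite) (S : Set (Subst F))
    (hS : ∀ σ ∈ S, Unifier E Γ σ)
    (hvars : ∀ σ ∈ S, σ.VRan ∪ σ.Dom ⊆ VarsP Γ)
    (hcomp : CompleteSet E Γ (VarsP Γ) S ∨ CompleteSet E Γ Set.univ S) :
    (TypeUnitary E Γ (VarsP Γ) ↔ TypeUnitary E Γ Set.univ) ∧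
    (TypeFinitary E Γ (VarsP Γ) ↔ TypeFinitary E Γ Set.univ) ∧
    (TypeInfinitary E Γ (VarsP Γ) ↔ TypeInfinitary E Γ Set.univ) ∧
    (TypeZero E Γ (VarsP Γ) ↔ TypeZero E Γ Set.univ) := by
  have hle : ∀ σ ∈ S, ∀ θ, InstLE E (VarsP Γ) σ θ ↔ InstLE E Set.univ σ θ :=
    fun σ hσ θ => instLE_iff_univ (hvars σ hσ) θ
  have hX : CompleteSet E Γ (VarsP Γ) S := hcomp.elim id (completeSet_congr hle).2
  obtain ⟨u, f, i, z⟩ := types_imp_of_instLE_iff hX hle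
  obtain ⟨u', f', i', z'⟩ := types_imp_of_instLE_iff ((completeSet_congr hle).1 hX)
    fun σ hσ θ => (hle σ hσ θ).symm
  exact ⟨⟨u, u'⟩, ⟨f, f'⟩, ⟨i, i'⟩, ⟨z', z⟩⟩
end UnifFW
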